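/- T_{max,2}(20) = 96, T_{max,3}(20) = 126, and T_{max,4}(20) = 150; in particular, for l = 20 the function m1 ↦ T_{max,m1}(20) is strictly increasing on {1, 2, 3, 4}. -/

import Mathlib

open MvPolynomial

/-- A monomial ideal: an ideal containing the monomials of all its elements. -/
def IsMonomialIdeal (I : Ideal (MvPolynomial (Fin 3) ℂ)) : Prop :=
  ∀ p ∈ I, ∀ d ∈ p.support, (monomial d (1 : ℂ)) ∈ I

/-- Borel-fixed (strongly stable) in characteristic 0: for every monomial in `I`
divisible by `x_j`, and every `i < j`, replacing one factor `x_j` by `x_i`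
stays in `I`. -/
def IsBorelFixed (I : Ideal (MvPolynomial (Fin 3) ℂ)) : Prop :=
  ∀ d : Fin 3 →₀ ℕ, (monomial d (1 : ℂ)) ∈ I →
    ∀ i j : Fin 3, i < j → 0 < d j →
      (monomial (d + Finsupp.single i 1 - Finsupp.single j 1) (1 : ℂ)) ∈ I

/-- The dimension of the tangent space to the Hilbert scheme at `[I]`,
namely `dim_ℂ Hom_R(I, R/I)`. -/
noncomputable def tangentDim (I : Ideal (MvPolynomial (Fin 3) ℂ)) : ℕ :=
  Module.finrank ℂ (↥I →ₗ[MvPolynomial (Fin 3) ℂ] (MvPolynomial (Fin 3) ℂ ⧸ I))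

/-- `TmaxEq l m1 T` says that `T` is the maximum of `dim_ℂ Hom_R(I, R/I)` over all
Borel-fixed monomial ideals `I ⊆ ℂ[x,y,z]` of colength `l` whose smallest pure power
of `x` lying in `I` is `x^{m1}`. -/
def TmaxEq (l m1 T : ℕ) : Prop :=
  IsGreatest { t : ℕ | ∃ I : Ideal (MvPolynomial (Fin 3) ℂ),
      IsMonomialIdeal I ∧ IsBorelFixed I ∧
      Module.finrank ℂ (MvPolynomial (Fin 3) ℂ ⧸ I) = l ∧
      (X 0 : MvPolynomial (Fin 3) ℂ) ^ m1 ∈ I ∧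
      (X 0 : MvPolynomial (Fin 3) ℂ) ^ (m1 - 1) ∉ I ∧
      t = tangentDim I } T

/-! ### Coefficients in the quotient by a monomial ideal -/

section Coefficients

variable {I : Ideal (MvPolynomial (Fin 3) ℂ)}

lemma monomial_mem_of_le {d e : Fin 3 →₀ ℕ} (hd : monomial d (1 : ℂ) ∈ I) (h : d ≤ e) :
    monomial e (1 : ℂ) ∈ I := by
  have : monomial e (1 : ℂ) = monomial (e - d) 1 * monomial d 1 := by
    rw [monomial_mul, tsub_add_cancel_of_le h, one_mul]
  rw [this]
  exact I.mul_mem_left _ hd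

open Classical in
/-- The coefficient of a standard monomial in a class modulo a monomial ideal; it is zero
on the exponents of monomials in the ideal. -/
noncomputable def quotCoeff (hI : IsMonomialIdeal I) (d : Fin 3 →₀ ℕ) :
    (MvPolynomial (Fin 3) ℂ ⧸ I) →ₗ[ℂ] ℂ :=
  ((I.restrictScalars ℂ).liftQ (if monomial d (1 : ℂ) ∈ I then 0 else lcoeff ℂ d) (by
      intro p hp
      by_cases hd : monomial d (1 : ℂ) ∈ I
      · simp [hd]
      · have hp' : p ∈ I := hp
        simp only [hd, if_false, LinearMap.mem_ker, lcoeff_apply]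
        by_contra hne
        exact hd (hI p hp' d (mem_support_iff.mpr hne)))) ∘ₗ
    (Submodule.Quotient.restrictScalarsEquiv ℂ I).symm.toLinearMap

lemma quotCoeff_mk (hI : IsMonomialIdeal I) {d : Fin 3 →₀ ℕ} (hd : monomial d (1 : ℂ) ∉ I)
    (p : MvPolynomial (Fin 3) ℂ) :
    quotCoeff hI d (Ideal.Quotient.mk I p) = coeff d p := by
  classical
  have : quotCoeff hI d (Ideal.Quotient.mk I p) =
      (if monomial d (1 : ℂ) ∈ I then (0 : MvPolynomial (Fin 3) ℂ →ₗ[ℂ] ℂ)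
        else lcoeff ℂ d) p := rfl
  rw [this, if_neg hd, lcoeff_apply]

lemma quotCoeff_smul (hI : IsMonomialIdeal I) {d : Fin 3 →₀ ℕ} (hd : monomial d (1 : ℂ) ∉ I)
    (w : Fin 3 →₀ ℕ) (q : MvPolynomial (Fin 3) ℂ ⧸ I) :
    quotCoeff hI d (monomial w (1 : ℂ) • q) = if w ≤ d then quotCoeff hI (d - w) q else 0 := by
  obtain ⟨p, rfl⟩ := Ideal.Quotient.mk_surjective q
  have : monomial w (1 : ℂ) • Ideal.Quotient.mk I p =
    Ideal.Quotient.mk I (monomial w (1 : ℂ) * p) := rfl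
  rw [this, quotCoeff_mk hI hd, coeff_monomial_mul']
  split_ifs with h
  · rw [quotCoeff_mk hI fun h' => hd (monomial_mem_of_le h' tsub_le_self), one_mul]
  · rfl

lemma mem_of_forall_support {p : MvPolynomial (Fin 3) ℂ}
    (h : ∀ d ∈ p.support, monomial d (1 : ℂ) ∈ I) : p ∈ I := by
  rw [p.as_sum]
  refine I.sum_mem fun d hd => ?_
  rw [← mul_one (coeff d p), ← C_mul_monomial]
  exact I.mul_mem_left _ (h d hd)

lemma quotCoeff_ext (hI : IsMonomialIdeal I) {q q' : MvPolynomial (Fin 3) ℂ ⧸ I}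
    (h : ∀ d, monomial d (1 : ℂ) ∉ I → quotCoeff hI d q = quotCoeff hI d q') : q = q' := by
  obtain ⟨p, rfl⟩ := Ideal.Quotient.mk_surjective q
  obtain ⟨p', rfl⟩ := Ideal.Quotient.mk_surjective q'
  rw [Ideal.Quotient.eq]
  refine mem_of_forall_support fun d hd => ?_
  by_contra hdI
  have := h d hdI
  rw [quotCoeff_mk hI hdI, quotCoeff_mk hI hdI] at this
  simp [this] at hd

lemma finrank_quotient_eq_card (hI : IsMonomialIdeal I) :
    Module.finrank ℂ (MvPolynomial (Fin 3) ℂ ⧸ I) =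
      Nat.card {d : Fin 3 →₀ ℕ // monomial d (1 : ℂ) ∉ I} := by
  let v : {d : Fin 3 →₀ ℕ // monomial d (1 : ℂ) ∉ I} → (MvPolynomial (Fin 3) ℂ ⧸ I) :=
    fun d => Ideal.Quotient.mk I (monomial d.1 1)
  have hli : LinearIndependent ℂ v := by
    rw [linearIndependent_iff']
    intro s c hc d hd
    have := congrArg (quotCoeff hI d.1) hc
    rw [map_sum, map_zero, Finset.sum_eq_single d] at this
    · simpa [v, quotCoeff_mk hI d.2] using this
    · intro e _ hed
      have : (e : Fin 3 →₀ ℕ) ≠ d := fun h => hed (Subtype.ext h)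
      simp [v, quotCoeff_mk hI d.2, coeff_monomial, this]
    · exact fun h => (h hd).elim
  have hspan : ⊤ ≤ Submodule.span ℂ (Set.range v) := by
    intro q _
    obtain ⟨p, rfl⟩ := Ideal.Quotient.mk_surjective q
    rw [p.as_sum, map_sum]
    refine Submodule.sum_mem _ fun d _ => ?_
    by_cases hd : monomial d (1 : ℂ) ∈ I
    · have : Ideal.Quotient.mk I (monomial d (coeff d p)) = 0 := by
        rw [Ideal.Quotient.eq_zero_iff_mem, ← mul_one (coeff d p), ← C_mul_monomial]
        exact I.mul_mem_left _ hd
      rw [this]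
      exact Submodule.zero_mem _
    · have : Ideal.Quotient.mk I (monomial d (coeff d p)) = coeff d p • v ⟨d, hd⟩ := by
        change _ = Ideal.Quotient.mk I (coeff d p • monomial d 1)
        rw [smul_monomial, smul_eq_mul, mul_one]
      rw [this]
      exact Submodule.smul_mem _ _ (Submodule.subset_span ⟨_, rfl⟩)
  exact Module.finrank_eq_nat_card_basis (Module.Basis.mk hli hspan)

end Coefficients

/-! ### Tangent vectors in coordinates -/

section Tangent

variable {I : Ideal (MvPolynomial (Fin 3) ℂ)}

open Classical in
/-- The coefficient of `x ^ d` in the image of `x ^ g`, as a functional on `Hom(I, R/I)`. -/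
noncomputable def homCoeff (hI : IsMonomialIdeal I) (g d : Fin 3 →₀ ℕ) :
    (↥I →ₗ[MvPolynomial (Fin 3) ℂ] (MvPolynomial (Fin 3) ℂ ⧸ I)) →ₗ[ℂ] ℂ :=
  if hg : monomial g (1 : ℂ) ∈ I then
    { toFun := fun φ => quotCoeff hI d (φ ⟨_, hg⟩)
      map_add' := fun φ ψ => by simp
      map_smul' := fun c φ => by simp }
  else 0

lemma homCoeff_apply (hI : IsMonomialIdeal I) {g : Fin 3 →₀ ℕ} (hg : monomial g (1 : ℂ) ∈ I)
    (d : Fin 3 →₀ ℕ) (φ : ↥I →ₗ[MvPolynomial (Fin 3) ℂ] (MvPolynomial (Fin 3) ℂ ⧸ I)) :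
    homCoeff hI g d φ = quotCoeff hI d (φ ⟨_, hg⟩) := by
  simp [homCoeff, hg]

lemma homCoeff_relation (hI : IsMonomialIdeal I) {g h d : Fin 3 →₀ ℕ}
    (hg : monomial g (1 : ℂ) ∈ I) (hh : monomial h (1 : ℂ) ∈ I)
    (hd : monomial (d + (h - g)) (1 : ℂ) ∉ I)
    (φ : ↥I →ₗ[MvPolynomial (Fin 3) ℂ] (MvPolynomial (Fin 3) ℂ ⧸ I)) :
    homCoeff hI g d φ = if g ≤ d + h then homCoeff hI h (d + h - g) φ else 0 := by
  have hsyz : monomial (h - g) (1 : ℂ) • (⟨_, hg⟩ : I) = monomial (g - h) (1 : ℂ) • ⟨_, hh⟩ := by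
    apply Subtype.ext
    change monomial (h - g) (1 : ℂ) * monomial g 1 = monomial (g - h) 1 * monomial h 1
    rw [monomial_mul, monomial_mul]
    congr 2
    ext i
    simp only [Finsupp.add_apply, Finsupp.tsub_apply]
    omega
  have key := congrArg (quotCoeff hI (d + (h - g))) (congrArg φ hsyz)
  rw [φ.map_smul, φ.map_smul, quotCoeff_smul hI hd, quotCoeff_smul hI hd,
    if_pos (le_add_of_nonneg_left zero_le), add_tsub_cancel_right] at key
  rw [homCoeff_apply hI hg, homCoeff_apply hI hh, key]
  have hiff : g - h ≤ d + (h - g) ↔ g ≤ d + h := by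
    simp only [Finsupp.le_def, Finsupp.add_apply, Finsupp.tsub_apply]
    refine forall_congr' fun i => ?_
    omega
  have heq : d + (h - g) - (g - h) = d + h - g := by
    ext i
    simp only [Finsupp.add_apply, Finsupp.tsub_apply]
    omega
  simp only [hiff, heq]

lemma hom_eq_zero (hI : IsMonomialIdeal I) {G : Set (Fin 3 →₀ ℕ)}
    (hG : ∀ m, monomial m (1 : ℂ) ∈ I → ∃ g ∈ G, g ≤ m ∧ monomial g (1 : ℂ) ∈ I)
    (φ : ↥I →ₗ[MvPolynomial (Fin 3) ℂ] (MvPolynomial (Fin 3) ℂ ⧸ I))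
    (hφ : ∀ g ∈ G, ∀ d, monomial d (1 : ℂ) ∉ I → homCoeff hI g d φ = 0) : φ = 0 := by
  have hmon : ∀ m (hm : monomial m (1 : ℂ) ∈ I), φ ⟨_, hm⟩ = 0 := by
    intro m hm
    obtain ⟨g, hgG, hgm, hg⟩ := hG m hm
    have hz : φ ⟨_, hg⟩ = 0 := quotCoeff_ext hI fun d hd => by
      rw [← homCoeff_apply hI hg, hφ g hgG d hd, map_zero]
    have : (⟨_, hm⟩ : I) = monomial (m - g) (1 : ℂ) • ⟨_, hg⟩ := by
      apply Subtype.ext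
      simp [monomial_mul, tsub_add_cancel_of_le hgm]
    rw [this, map_smul, hz, smul_zero]
  refine LinearMap.ext fun ⟨p, hp⟩ => ?_
  have hsum : (⟨p, hp⟩ : I) = ∑ d ∈ p.support.attach,
      (C (coeff d.1 p) : MvPolynomial (Fin 3) ℂ) •
        (⟨monomial d.1 (1 : ℂ), hI p hp d.1 d.2⟩ : I) := by
    apply Subtype.ext
    simp only [AddSubmonoidClass.coe_finsetSum, SetLike.mk_smul_mk, smul_eq_mul,
      C_mul_monomial, mul_one]
    rw [Finset.sum_attach p.support fun d => monomial d (coeff d p)]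
    exact p.as_sum
  rw [hsum, map_sum, LinearMap.zero_apply]
  exact Finset.sum_eq_zero fun d _ => by rw [φ.map_smul, hmon, smul_zero]

/-- A tangent vector exists with prescribed coefficients on generators, as soon as these
satisfy the relations coming from pairs of generators. -/
lemma exists_hom (hI : IsMonomialIdeal I) {G : Set (Fin 3 →₀ ℕ)}
    (hGI : ∀ g ∈ G, monomial g (1 : ℂ) ∈ I)
    (hG : ∀ m, monomial m (1 : ℂ) ∈ I → ∃ g ∈ G, g ≤ m)
    (hfin : {d : Fin 3 →₀ ℕ | monomial d (1 : ℂ) ∉ I}.Finite)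
    (f : (Fin 3 →₀ ℕ) → (Fin 3 →₀ ℕ) → ℂ)
    (hf : ∀ g ∈ G, ∀ h ∈ G, ∀ d, monomial (d + (h - g)) (1 : ℂ) ∉ I →
      f g d = if g ≤ d + h then f h (d + h - g) else 0) :
    ∃ φ : ↥I →ₗ[MvPolynomial (Fin 3) ℂ] (MvPolynomial (Fin 3) ℂ ⧸ I),
      ∀ g ∈ G, ∀ d, monomial d (1 : ℂ) ∉ I → homCoeff hI g d φ = f g d := by
  classical
  have hwd : ∀ m d, monomial d (1 : ℂ) ∉ I → ∀ g ∈ G, ∀ h ∈ G, g ≤ m → h ≤ m → m - g ≤ d →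
      f g (d - (m - g)) = if m - h ≤ d then f h (d - (m - h)) else 0 := by
    intro m d hd g hg h hh hgm hhm hgd
    have hM : monomial (d - (m - g) + (h - g)) (1 : ℂ) ∉ I := by
      refine fun hmem => hd (monomial_mem_of_le hmem fun i => ?_)
      have h1 := hgm i; have h2 := hhm i; have h3 := hgd i
      simp only [Finsupp.add_apply, Finsupp.tsub_apply] at *
      omega
    rw [hf g hg h hh _ hM]
    have hiff : g ≤ d - (m - g) + h ↔ m - h ≤ d := by
      simp only [Finsupp.le_def, Finsupp.add_apply, Finsupp.tsub_apply]
      refine forall_congr' fun i => ?_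
      have h1 := hgm i; have h2 := hhm i; have h3 := hgd i
      simp only [Finsupp.tsub_apply] at h3
      omega
    simp only [hiff]
    split_ifs with hc
    · congr 1
      ext i
      have h1 := hgm i; have h2 := hhm i; have h3 := hgd i; have h4 := hc i
      simp only [Finsupp.add_apply, Finsupp.tsub_apply] at *
      omega
    · rfl
  choose! gen hgenG hgenle using hG
  let F : (Fin 3 →₀ ℕ) → (Fin 3 →₀ ℕ) → ℂ := fun m d =>
    if m - gen m ≤ d then f (gen m) (d - (m - gen m)) else 0
  have hF : ∀ m, monomial m (1 : ℂ) ∈ I → ∀ d, monomial d (1 : ℂ) ∉ I → ∀ g ∈ G, g ≤ m →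
      F m d = if m - g ≤ d then f g (d - (m - g)) else 0 := by
    intro m hm d hd g hg hgm
    have e1 := hwd m d hd (gen m) (hgenG m hm) g hg (hgenle m hm) hgm
    have e2 := hwd m d hd g hg (gen m) (hgenG m hm) hgm (hgenle m hm)
    by_cases c1 : m - gen m ≤ d
    · simp only [F, if_pos c1, e1 c1]
    · by_cases c2 : m - g ≤ d
      · simp only [F, if_neg c1, if_pos c2, e2 c2]
      · simp only [F, if_neg c1, if_neg c2]
  have hFshift : ∀ m, monomial m (1 : ℂ) ∈ I → ∀ w d, monomial d (1 : ℂ) ∉ I →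
      F (w + m) d = if w ≤ d then F m (d - w) else 0 := by
    intro m hm w d hd
    have hle : gen m ≤ w + m := (hgenle m hm).trans (le_add_of_nonneg_left zero_le)
    rw [hF (w + m) (monomial_mem_of_le hm (le_add_of_nonneg_left zero_le)) d hd (gen m)
      (hgenG m hm) hle]
    have hsub : w + m - gen m = w + (m - gen m) := add_tsub_assoc_of_le (hgenle m hm) w
    rw [hsub]
    by_cases hw : w ≤ d
    · have : w + (m - gen m) ≤ d ↔ m - gen m ≤ d - w := by
        rw [add_comm]; exact (le_tsub_iff_right hw).symm
      simp only [F, hw, if_true, this, tsub_tsub]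
    · rw [if_neg hw, if_neg fun h => hw ((le_add_of_nonneg_right zero_le).trans h)]
  let img : (Fin 3 →₀ ℕ) → MvPolynomial (Fin 3) ℂ ⧸ I := fun m =>
    Ideal.Quotient.mk I (∑ d ∈ hfin.toFinset, monomial d (F m d))
  have himg : ∀ m d, monomial d (1 : ℂ) ∉ I → quotCoeff hI d (img m) = F m d := by
    intro m d hd
    simp only [img]
    rw [quotCoeff_mk hI hd, coeff_sum]
    simp only [coeff_monomial]
    rw [Finset.sum_ite_eq' hfin.toFinset d]
    simp [hd]
  have himgshift : ∀ m, monomial m (1 : ℂ) ∈ I → ∀ w,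
      img (w + m) = monomial w (1 : ℂ) • img m := by
    intro m hm w
    refine quotCoeff_ext hI fun d hd => ?_
    rw [himg _ _ hd, quotCoeff_smul hI hd, hFshift m hm w d hd]
    split_ifs with hw
    · rw [himg _ _ fun h => hd (monomial_mem_of_le h tsub_le_self)]
    · rfl
  let Φ : MvPolynomial (Fin 3) ℂ →ₗ[ℂ] (MvPolynomial (Fin 3) ℂ ⧸ I) :=
    (basisMonomials (Fin 3) ℂ).constr ℂ img
  have hΦ : ∀ m c, Φ (monomial m c) = c • img m := by
    intro m c
    have h1 : Φ (monomial m 1) = img m := by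
      have := (basisMonomials (Fin 3) ℂ).constr_basis ℂ img m
      rwa [coe_basisMonomials] at this
    rw [← h1, ← map_smul, smul_monomial, smul_eq_mul, mul_one]
  have hΦmon : ∀ w c, ∀ p ∈ I, Φ (monomial w c * p) = monomial w c • Φ p := by
    intro w c p hp
    have hsum : ∀ q : MvPolynomial (Fin 3) ℂ,
        q * p = ∑ d ∈ p.support, q * monomial d (coeff d p) := fun q => by
      rw [← Finset.mul_sum, ← p.as_sum]
    conv_rhs => rw [p.as_sum]
    rw [hsum, map_sum, map_sum, Finset.smul_sum]
    refine Finset.sum_congr rfl fun d hd => ?_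
    have hw : monomial w c = c • monomial w (1 : ℂ) := by simp [smul_monomial]
    rw [monomial_mul, hΦ, hΦ, himgshift d (hI p hp d hd), hw, smul_assoc, mul_smul,
      smul_comm (monomial w (1 : ℂ)) (coeff d p)]
  have hΦsmul : ∀ q : MvPolynomial (Fin 3) ℂ, ∀ p ∈ I, Φ (q * p) = q • Φ p := by
    intro q p hp
    induction q using MvPolynomial.induction_on' with
    | monomial w c => exact hΦmon w c p hp
    | add q q' hq hq' => rw [add_mul, map_add, hq, hq', add_smul]
  refine ⟨{ toFun := fun p => Φ p.1
            map_add' := fun p q => by simp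
            map_smul' := fun q p => by
              simpa using hΦsmul q p.1 p.2 }, fun g hg d hd => ?_⟩
  rw [homCoeff_apply hI (hGI g hg)]
  change quotCoeff hI d (Φ (monomial g 1)) = _
  rw [hΦ, one_smul, himg _ _ hd, hF g (hGI g hg) d hd g hg le_rfl]
  simp

end Tangent

/-! ### Staircases and the elimination algorithm -/

/-- Exponents of a monomial in `x, y, z`. -/
abbrev Exponent := ℕ × ℕ × ℕ

/-- The staircase of a monomial ideal is recorded by a table `L` of column heights. -/
def height (L : List (List ℕ)) (i j : ℕ) : ℕ := (L.getD i []).getD j 0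

/-- Whether an exponent lies under the staircase. -/
def inStd (L : List (List ℕ)) (t : Exponent) : Bool := Nat.blt t.2.2 (height L t.1 t.2.1)

/-- The exponents under the staircase. -/
def stdList (L : List (List ℕ)) : List Exponent :=
  (List.range L.length).flatMap fun i =>
    (List.range (L.getD i []).length).flatMap fun j =>
      (List.range (height L i j)).map fun k => (i, j, k)

/-- Generators of the ideal above the staircase. -/
def genList (L : List (List ℕ)) : List Exponent :=
  ((List.range L.length).flatMap fun i =>
    (List.range ((L.getD i []).length + 1)).map fun j => (i, j, height L i j)) ++ [(L.length, 0, 0)]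

/-- The exponent `d + (h - g)⁺`. -/
def upTo (g h d : Exponent) : Exponent :=
  (d.1 + (h.1 - g.1), d.2.1 + (h.2.1 - g.2.1), d.2.2 + (h.2.2 - g.2.2))

/-- The exponent `d + h - g`. -/
def transport (g h d : Exponent) : Exponent :=
  (d.1 + h.1 - g.1, d.2.1 + h.2.1 - g.2.1, d.2.2 + h.2.2 - g.2.2)

/-- Whether `d + h - g` has nonnegative coordinates. -/
def transports (g h d : Exponent) : Bool :=
  Nat.ble g.1 (d.1 + h.1) && Nat.ble g.2.1 (d.2.1 + h.2.1) && Nat.ble g.2.2 (d.2.2 + h.2.2)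

/-- Whether all coordinates are less than `32`. -/
def inBox (t : Exponent) : Bool := Nat.blt t.1 32 && Nat.blt t.2.1 32 && Nat.blt t.2.2 32

/-- Positional encoding of exponents, so that sets of exponents become bit masks. -/
def code (t : Exponent) : ℕ := (t.1 * 64 + t.2.1) * 64 + t.2.2

/-- The code of `(a - b)⁺`. This and the following functions call the operations of `ℕ` directly
instead of through notation classes, which makes evaluation in the kernel twice as fast. -/
def codeSub (a b : Exponent) : ℕ :=
  Nat.add (Nat.mul (Nat.add (Nat.mul (Nat.sub a.1 b.1) 64) (Nat.sub a.2.1 b.2.1)) 64)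
    (Nat.sub a.2.2 b.2.2)

/-- Continue with the normal form of a natural number. -/
def force {α : Type} (n : ℕ) (f : ℕ → α) : α :=
  match n with
  | 0 => f 0
  | m + 1 => f (m + 1)

/-- The bit mask with the given bits. -/
def maskOf (D : List ℕ) : ℕ := D.foldr (fun c m => m ||| 1 <<< c) 0

/-- The mask of those standard `d` for which `d + (h - g)⁺` is standard. -/
def common (M : ℕ) (g h : Exponent) : ℕ := Nat.land M (Nat.shiftRight M (codeSub h g))

/-- The mask of those `d` whose coefficient at the generator `g` vanishes because of the relation
with one of the generators `h` in the list, where `Z` is a mask of coefficients already known to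
vanish at `h`. -/
def killed (M : ℕ) (g : Exponent) : List (Exponent × ℕ) → ℕ
  | [] => 0
  | (h, Z) :: l =>
    Nat.lor
      (force (common M g h) fun A =>
        Nat.lor (Nat.xor A (Nat.land A (Nat.shiftLeft M (codeSub g h))))
          (Nat.land A (Nat.shiftRight (Nat.shiftLeft Z (codeSub g h)) (codeSub h g))))
      (killed M g l)

/-- One round of propagating vanishing coefficients. -/
def propagate (M : ℕ) (Zs : List (Exponent × ℕ)) : List (Exponent × ℕ) :=
  Zs.map fun p => (p.1, killed M p.1 Zs)

/-- The mask of those `d` whose coefficient at `g` is tied to one at a generator in the list. -/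
def earlier (M : ℕ) (g : Exponent) : List Exponent → ℕ
  | [] => 0
  | h :: l => Nat.lor (common M g h) (earlier M g l)

/-- The coefficients that are not eliminated. -/
def freeNodes (M : ℕ) (D : List Exponent) :
    List Exponent → List (Exponent × ℕ) → List (Exponent × Exponent)
  | _, [] => []
  | prev, (g, Z) :: l =>
    ((D.filter fun d => !((Z ||| earlier M g prev).testBit (code d))).map fun d => (g, d)) ++
      freeNodes M D (g :: prev) l

/-- The number of coefficients that are not eliminated. -/
def freeCount (M : ℕ) (D : List ℕ) : List Exponent → List (Exponent × ℕ) → ℕ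
  | _, [] => 0
  | prev, (g, Z) :: l =>
    (force (Nat.lor Z (earlier M g prev)) fun z =>
      D.countP fun c => Nat.beq (Nat.land 1 (Nat.shiftRight z c)) 0) +
      freeCount M D (g :: prev) l

/-- Certifies that at most `b` coefficients determine a tangent vector. -/
def boundedBy (L : List (List ℕ)) (b : ℕ) : Bool :=
  let D := (stdList L).map code
  ((stdList L).all inBox && (genList L).all inBox) &&
  force (maskOf D) fun M =>
    let Z := propagate M ((genList L).map fun g => (g, 0))
    Nat.ble (freeCount M D [] Z) b || Nat.ble (freeCount M D [] (propagate M (propagate M Z))) b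

section Elimination

lemma force_eq {α : Type} (n : ℕ) (f : ℕ → α) : force n f = f n := by
  cases n <;> rfl

lemma codeSub_eq (a b : Exponent) :
    codeSub a b = ((a.1 - b.1) * 64 + (a.2.1 - b.2.1)) * 64 + (a.2.2 - b.2.2) := rfl

lemma common_eq (M : ℕ) (g h : Exponent) : common M g h = M &&& (M >>> codeSub h g) := rfl

lemma killed_cons (M : ℕ) (g h : Exponent) (Z : ℕ) (l : List (Exponent × ℕ)) :
    killed M g ((h, Z) :: l) = (common M g h ^^^ (common M g h &&& (M <<< codeSub g h))) |||
      (common M g h &&& ((Z <<< codeSub g h) >>> codeSub h g)) ||| killed M g l := by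
  rw [killed, force_eq]
  rfl

lemma earlier_cons (M : ℕ) (g h : Exponent) (l : List Exponent) :
    earlier M g (h :: l) = common M g h ||| earlier M g l := rfl

lemma freeCount_cons (M : ℕ) (D : List ℕ) (prev : List Exponent) (g : Exponent) (Z : ℕ)
    (l : List (Exponent × ℕ)) : freeCount M D prev ((g, Z) :: l) =
      (D.countP fun c => !(Z ||| earlier M g prev).testBit c) + freeCount M D (g :: prev) l := by
  have hbit : ∀ z c : ℕ, Nat.beq (Nat.land 1 (Nat.shiftRight z c)) 0 = !z.testBit c := by
    intro z c
    rw [Nat.testBit, bne, Bool.not_not, Bool.eq_iff_iff, Nat.beq_eq, beq_iff_eq]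
    rfl
  simp only [freeCount, force_eq, hbit]
  rfl

lemma height_of_length_le {L : List (List ℕ)} {i : ℕ} (h : L.length ≤ i) (j : ℕ) :
    height L i j = 0 := by
  rw [height, List.getD_eq_default _ _ h]
  rfl

lemma height_of_row_length_le {L : List (List ℕ)} {i j : ℕ} (h : (L.getD i []).length ≤ j) :
    height L i j = 0 :=
  List.getD_eq_default _ _ h

lemma inStd_iff {L : List (List ℕ)} {t : Exponent} :
    inStd L t = true ↔ t.2.2 < height L t.1 t.2.1 := by
  simp [inStd]

lemma inStd_eq_false_iff {L : List (List ℕ)} {t : Exponent} :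
    inStd L t = false ↔ height L t.1 t.2.1 ≤ t.2.2 := by
  rw [Bool.eq_false_iff, ne_eq, inStd_iff, not_lt]

lemma mem_stdList {L : List (List ℕ)} {t : Exponent} : t ∈ stdList L ↔ inStd L t = true := by
  obtain ⟨i, j, k⟩ := t
  rw [inStd_iff]
  simp only [stdList, List.mem_flatMap, List.mem_range, List.mem_map, Prod.mk.injEq]
  constructor
  · rintro ⟨i', _, j', _, k', hk, rfl, rfl, rfl⟩
    exact hk
  · intro hk
    refine ⟨i, ?_, j, ?_, k, hk, rfl, rfl, rfl⟩
    · by_contra h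
      simp [height_of_length_le (not_lt.mp h)] at hk
    · by_contra h
      simp [height_of_row_length_le (not_lt.mp h)] at hk

lemma inStd_of_mem_genList {L : List (List ℕ)} {g : Exponent} (hg : g ∈ genList L) :
    inStd L g = false := by
  simp only [genList, List.mem_append, List.mem_flatMap, List.mem_range, List.mem_map,
    List.mem_singleton] at hg
  rcases hg with ⟨i, _, j, _, rfl⟩ | rfl
  · exact inStd_eq_false_iff.mpr le_rfl
  · exact inStd_eq_false_iff.mpr (height_of_length_le le_rfl _).le

lemma exists_mem_genList {L : List (List ℕ)} {t : Exponent} (ht : inStd L t = false) :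
    ∃ g ∈ genList L, g ≤ t := by
  obtain ⟨i, j, k⟩ := t
  have hk : height L i j ≤ k := inStd_eq_false_iff.mp ht
  rcases lt_or_ge i L.length with hi | hi
  · refine ⟨(i, min j (L.getD i []).length, height L i (min j (L.getD i []).length)), ?_, ?_⟩
    · simp only [genList, List.mem_append, List.mem_flatMap, List.mem_range, List.mem_map]
      exact Or.inl ⟨i, hi, _, by omega, rfl⟩
    · refine ⟨le_rfl, min_le_left _ _, ?_⟩
      rcases le_total j (L.getD i []).length with h | h
      · rwa [min_eq_left h]
      · rw [min_eq_right h, height_of_row_length_le le_rfl]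
        exact Nat.zero_le _
  · exact ⟨(L.length, 0, 0), by simp [genList], hi, Nat.zero_le _, Nat.zero_le _⟩

lemma testBit_maskOf (D : List ℕ) (n : ℕ) : (maskOf D).testBit n = true ↔ n ∈ D := by
  induction D with
  | nil => simp [maskOf]
  | cons c D ih =>
    have : maskOf (c :: D) = maskOf D ||| 1 <<< c := rfl
    rw [this, Nat.testBit_or, Bool.or_eq_true, ih, Nat.one_shiftLeft, Nat.testBit_two_pow,
      decide_eq_true_eq, List.mem_cons, or_comm, eq_comm]

lemma inBox_iff {t : Exponent} : inBox t = true ↔ t.1 < 32 ∧ t.2.1 < 32 ∧ t.2.2 < 32 := by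
  simp [inBox, and_assoc]

lemma transports_iff {g h d : Exponent} : transports g h d = true ↔
    g.1 ≤ d.1 + h.1 ∧ g.2.1 ≤ d.2.1 + h.2.1 ∧ g.2.2 ≤ d.2.2 + h.2.2 := by
  simp [transports, and_assoc]

lemma code_upTo (g h d : Exponent) : code (upTo g h d) = codeSub h g + code d := by
  simp only [code, upTo, codeSub_eq]
  ring

lemma code_upTo_eq_transport {g h d : Exponent} (ht : transports g h d = true) :
    code (upTo g h d) = codeSub g h + code (transport g h d) := by
  rw [transports_iff] at ht
  simp only [code, upTo, codeSub_eq, transport]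
  omega

variable {L : List (List ℕ)}

lemma inStd_of_testBit (hbox : ∀ t, inStd L t = true → inBox t = true) {t : Exponent}
    (ht : t.1 < 64 ∧ t.2.1 < 64 ∧ t.2.2 < 64)
    (h : (maskOf ((stdList L).map code)).testBit (code t) = true) : inStd L t = true := by
  rw [testBit_maskOf, List.mem_map] at h
  obtain ⟨s, hs, hst⟩ := h
  rw [mem_stdList] at hs
  have hb := inBox_iff.mp (hbox s hs)
  have : s = t := by
    obtain ⟨a, b, c⟩ := s
    obtain ⟨a', b', c'⟩ := t
    simp only [code] at hst
    simp only [Prod.mk.injEq]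
    dsimp only at hb ht
    omega
  rwa [← this]

lemma testBit_of_inStd {t : Exponent} (h : inStd L t = true) :
    (maskOf ((stdList L).map code)).testBit (code t) = true := by
  rw [testBit_maskOf]
  exact List.mem_map_of_mem (mem_stdList.mpr h)

lemma upTo_lt {g h d : Exponent} (hd : inBox d = true) (hh : inBox h = true) :
    (upTo g h d).1 < 64 ∧ (upTo g h d).2.1 < 64 ∧ (upTo g h d).2.2 < 64 := by
  rw [inBox_iff] at hd hh
  simp only [upTo]
  omega

lemma inStd_transport {g h d : Exponent}
    (hlow : ∀ s t : Exponent, s ≤ t → inStd L t = true → inStd L s = true)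
    (hu : inStd L (upTo g h d) = true) : inStd L (transport g h d) = true := by
  refine hlow _ _ ⟨?_, ?_, ?_⟩ hu <;> simp only [transport, upTo] <;> omega

lemma inStd_upTo_of_common
    (hbox : ∀ t, inStd L t = true → inBox t = true)
    (hgbox : ∀ g ∈ genList L, inBox g = true) {g h d : Exponent} (hh : h ∈ genList L)
    (hd : inStd L d = true)
    (hc : (common (maskOf ((stdList L).map code)) g h).testBit (code d) = true) :
    inStd L (upTo g h d) = true := by
  rw [common_eq, Nat.testBit_and, Nat.testBit_shiftRight, Bool.and_eq_true] at hc
  refine inStd_of_testBit hbox (upTo_lt (hbox d hd) (hgbox h hh)) ?_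
  rw [code_upTo]
  exact hc.2

lemma eq_zero_of_killed
    {F : Exponent → Exponent → ℂ}
    (hbox : ∀ t, inStd L t = true → inBox t = true)
    (hgbox : ∀ g ∈ genList L, inBox g = true)
    (hlow : ∀ s t : Exponent, s ≤ t → inStd L t = true → inStd L s = true)
    (hF : ∀ g ∈ genList L, ∀ h ∈ genList L, ∀ d, inStd L (upTo g h d) = true →
      F g d = if transports g h d then F h (transport g h d) else 0)
    {g d : Exponent} (hg : g ∈ genList L) (hd : inStd L d = true)
    (l : List (Exponent × ℕ)) (hl : ∀ p ∈ l, p.1 ∈ genList L ∧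
      ∀ e, inStd L e = true → p.2.testBit (code e) = true → F p.1 e = 0)
    (hk : (killed (maskOf ((stdList L).map code)) g l).testBit (code d) = true) : F g d = 0 := by
  induction l with
  | nil => simp [killed] at hk
  | cons p l ih =>
    obtain ⟨h, Z⟩ := p
    obtain ⟨hh, hZ⟩ := hl (h, Z) List.mem_cons_self
    rw [killed_cons, Nat.testBit_or, Bool.or_eq_true] at hk
    rcases hk with hk | hk
    · have hc : (common (maskOf ((stdList L).map code)) g h).testBit (code d) = true := by
        by_contra hne
        rw [Bool.not_eq_true] at hne
        simp only [Nat.testBit_or, Nat.testBit_xor, Nat.testBit_and, hne, Bool.false_and,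
          Bool.false_xor, Bool.or_self, Bool.false_eq_true] at hk
      have hu := inStd_upTo_of_common hbox hgbox hh hd hc
      rw [hF g hg h hh d hu]
      split_ifs with ht
      · have hs := inStd_transport hlow hu
        have hcode := code_upTo_eq_transport ht
        rw [code_upTo] at hcode
        simp only [Nat.testBit_or, Nat.testBit_xor, Nat.testBit_and, hc, Bool.true_and,
          Bool.true_xor, Bool.or_eq_true, Nat.testBit_shiftLeft, Nat.testBit_shiftRight, hcode,
          Nat.add_sub_cancel_left, ge_iff_le, Nat.le_add_right, decide_true] at hk
        rcases hk with hk | hk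
        · exfalso
          have hle : codeSub g h ≤ code d := by
            rw [transports_iff] at ht
            simp only [code, codeSub_eq]
            omega
          have hsub : code d - codeSub g h =
              code (d.1 - (g.1 - h.1), d.2.1 - (g.2.1 - h.2.1), d.2.2 - (g.2.2 - h.2.2)) := by
            rw [transports_iff] at ht
            simp only [code, codeSub_eq]
            omega
          rw [hsub, testBit_of_inStd (hlow _ d ⟨by simp, by simp, by simp⟩ hd)] at hk
          simp [hle] at hk
        · exact hZ _ hs hk
      · rfl
    · exact ih (fun p hp => hl p (List.mem_cons_of_mem _ hp)) hk

lemma propagate_sound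
    {F : Exponent → Exponent → ℂ}
    (hbox : ∀ t, inStd L t = true → inBox t = true)
    (hgbox : ∀ g ∈ genList L, inBox g = true)
    (hlow : ∀ s t : Exponent, s ≤ t → inStd L t = true → inStd L s = true)
    (hF : ∀ g ∈ genList L, ∀ h ∈ genList L, ∀ d, inStd L (upTo g h d) = true →
      F g d = if transports g h d then F h (transport g h d) else 0)
    (l : List (Exponent × ℕ)) (hl : ∀ p ∈ l, p.1 ∈ genList L ∧
      ∀ e, inStd L e = true → p.2.testBit (code e) = true → F p.1 e = 0) :
    ∀ p ∈ propagate (maskOf ((stdList L).map code)) l, p.1 ∈ genList L ∧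
      ∀ e, inStd L e = true → p.2.testBit (code e) = true → F p.1 e = 0 := by
  intro p hp
  obtain ⟨q, hq, rfl⟩ := List.mem_map.mp hp
  exact ⟨(hl q hq).1, fun e he hk =>
    eq_zero_of_killed hbox hgbox hlow hF (hl q hq).1 he l hl hk⟩

lemma eq_zero_of_earlier
    {F : Exponent → Exponent → ℂ}
    (hbox : ∀ t, inStd L t = true → inBox t = true)
    (hgbox : ∀ g ∈ genList L, inBox g = true)
    (hlow : ∀ s t : Exponent, s ≤ t → inStd L t = true → inStd L s = true)
    (hF : ∀ g ∈ genList L, ∀ h ∈ genList L, ∀ d, inStd L (upTo g h d) = true →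
      F g d = if transports g h d then F h (transport g h d) else 0)
    {g d : Exponent} (hg : g ∈ genList L) (hd : inStd L d = true)
    (l : List Exponent) (hl : ∀ h ∈ l, h ∈ genList L ∧ ∀ e, inStd L e = true → F h e = 0)
    (hk : (earlier (maskOf ((stdList L).map code)) g l).testBit (code d) = true) :
    F g d = 0 := by
  induction l with
  | nil => simp [earlier] at hk
  | cons h l ih =>
    rw [earlier_cons, Nat.testBit_or, Bool.or_eq_true] at hk
    rcases hk with hk | hk
    · obtain ⟨hh, hz⟩ := hl h List.mem_cons_self
      have hu := inStd_upTo_of_common hbox hgbox hh hd hk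
      rw [hF g hg h hh d hu, hz _ (inStd_transport hlow hu), ite_self]
    · exact ih (fun p hp => hl p (List.mem_cons_of_mem _ hp)) hk

lemma eq_zero_of_freeNodes
    {F : Exponent → Exponent → ℂ}
    (hbox : ∀ t, inStd L t = true → inBox t = true)
    (hgbox : ∀ g ∈ genList L, inBox g = true)
    (hlow : ∀ s t : Exponent, s ≤ t → inStd L t = true → inStd L s = true)
    (hF : ∀ g ∈ genList L, ∀ h ∈ genList L, ∀ d, inStd L (upTo g h d) = true →
      F g d = if transports g h d then F h (transport g h d) else 0)
    (l : List (Exponent × ℕ)) (prev : List Exponent)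
    (hprev : ∀ h ∈ prev, h ∈ genList L ∧ ∀ e, inStd L e = true → F h e = 0)
    (hl : ∀ p ∈ l, p.1 ∈ genList L ∧
      ∀ e, inStd L e = true → p.2.testBit (code e) = true → F p.1 e = 0)
    (hfree : ∀ p ∈ freeNodes (maskOf ((stdList L).map code)) (stdList L) prev l, F p.1 p.2 = 0) :
    ∀ p ∈ l, ∀ e, inStd L e = true → F p.1 e = 0 := by
  induction l generalizing prev with
  | nil => simp
  | cons q l ih =>
    obtain ⟨g, Z⟩ := q
    obtain ⟨hg, hZ⟩ := hl (g, Z) List.mem_cons_self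
    have hz : ∀ e, inStd L e = true → F g e = 0 := by
      intro e he
      cases hb : (Z ||| earlier (maskOf ((stdList L).map code)) g prev).testBit (code e) with
      | true =>
        rw [Nat.testBit_or, Bool.or_eq_true] at hb
        rcases hb with hb | hb
        · exact hZ e he hb
        · exact eq_zero_of_earlier hbox hgbox hlow hF hg he prev hprev hb
      | false =>
        refine hfree (g, e) (List.mem_append_left _ (List.mem_map_of_mem ?_))
        exact List.mem_filter.mpr ⟨mem_stdList.mpr he, by simp [hb]⟩
    intro p hp
    rcases List.mem_cons.mp hp with rfl | hp
    · exact hz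
    · refine ih (g :: prev) ?_ (fun p hp => hl p (List.mem_cons_of_mem _ hp))
        (fun p hp => hfree p (List.mem_append_right _ hp)) p hp
      intro h hh
      rcases List.mem_cons.mp hh with rfl | hh
      · exact ⟨hg, hz⟩
      · exact hprev h hh

lemma length_freeNodes (M : ℕ) (D : List Exponent) (prev : List Exponent)
    (l : List (Exponent × ℕ)) :
    (freeNodes M D prev l).length = freeCount M (D.map code) prev l := by
  induction l generalizing prev with
  | nil => rfl
  | cons q l ih =>
    obtain ⟨g, Z⟩ := q
    rw [freeNodes, freeCount_cons, List.length_append, List.length_map, ih, List.countP_map,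
      List.countP_eq_length_filter]
    rfl

/-- A successful certificate provides at most `b` coefficients that determine all others. -/
lemma exists_determining_nodes {b : ℕ} (hb : boundedBy L b = true)
    (hlow : ∀ s t : Exponent, s ≤ t → inStd L t = true → inStd L s = true) :
    ∃ S : List (Exponent × Exponent), S.length ≤ b ∧ ∀ F : Exponent → Exponent → ℂ,
      (∀ g ∈ genList L, ∀ h ∈ genList L, ∀ d, inStd L (upTo g h d) = true →
        F g d = if transports g h d then F h (transport g h d) else 0) →
      (∀ p ∈ S, F p.1 p.2 = 0) → ∀ g ∈ genList L, ∀ d, inStd L d = true → F g d = 0 := by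
  simp only [boundedBy, force_eq, Bool.and_eq_true, Bool.or_eq_true, Nat.ble_eq] at hb
  obtain ⟨⟨h1, hgbox⟩, hb⟩ := hb
  rw [List.all_eq_true] at h1 hgbox
  have hbox : ∀ t, inStd L t = true → inBox t = true := fun t ht => h1 t (mem_stdList.mpr ht)
  have main : ∀ Z : List (Exponent × ℕ), Z.map Prod.fst = genList L →
      freeCount (maskOf ((stdList L).map code)) ((stdList L).map code) [] Z ≤ b →
      (∀ F : Exponent → Exponent → ℂ,
        (∀ g ∈ genList L, ∀ h ∈ genList L, ∀ d, inStd L (upTo g h d) = true →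
          F g d = if transports g h d then F h (transport g h d) else 0) → ∀ p ∈ Z,
          p.1 ∈ genList L ∧ ∀ e, inStd L e = true → p.2.testBit (code e) = true → F p.1 e = 0) →
      ∃ S : List (Exponent × Exponent), S.length ≤ b ∧ ∀ F : Exponent → Exponent → ℂ,
        (∀ g ∈ genList L, ∀ h ∈ genList L, ∀ d, inStd L (upTo g h d) = true →
          F g d = if transports g h d then F h (transport g h d) else 0) →
        (∀ p ∈ S, F p.1 p.2 = 0) → ∀ g ∈ genList L, ∀ d, inStd L d = true → F g d = 0 := by
    intro Z hfst hcount hZ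
    refine ⟨freeNodes (maskOf ((stdList L).map code)) (stdList L) [] Z,
      by rwa [length_freeNodes], fun F hF hS g hg d hd => ?_⟩
    rw [← hfst] at hg
    obtain ⟨p, hp, rfl⟩ := List.mem_map.mp hg
    exact eq_zero_of_freeNodes hbox hgbox hlow hF Z [] (by simp) (hZ F hF) hS p hp d hd
  have hzero : ∀ F : Exponent → Exponent → ℂ, ∀ p ∈ (genList L).map fun g => (g, 0),
      p.1 ∈ genList L ∧ ∀ e, inStd L e = true → p.2.testBit (code e) = true → F p.1 e = 0 := by
    intro F p hp
    obtain ⟨g, hg, rfl⟩ := List.mem_map.mp hp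
    exact ⟨hg, fun e _ he => by simp at he⟩
  have hfst : ∀ M Z, (propagate M Z).map Prod.fst = Z.map Prod.fst := by
    intro M Z
    simp [propagate]
  rcases hb with hb | hb
  · refine main _ ?_ hb fun F hF => propagate_sound hbox hgbox hlow hF _ (hzero F)
    simp [hfst, Function.comp_def]
  · refine main _ ?_ hb fun F hF => propagate_sound hbox hgbox hlow hF _
      (propagate_sound hbox hgbox hlow hF _ (propagate_sound hbox hgbox hlow hF _ (hzero F)))
    simp [hfst, Function.comp_def]

end Elimination

/-! ### Monomial ideals with a given staircase -/

/-- The exponent `t` as a finitely supported function. -/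
noncomputable def expo (t : Exponent) : Fin 3 →₀ ℕ :=
  Finsupp.equivFunOnFinite.symm ![t.1, t.2.1, t.2.2]

/-- The staircase of `I` has column heights `L`. -/
def HasTable (I : Ideal (MvPolynomial (Fin 3) ℂ)) (L : List (List ℕ)) : Prop :=
  ∀ t : Exponent, monomial (expo t) (1 : ℂ) ∈ I ↔ inStd L t = false

/-- Whether the coefficient of `x ^ d` at the generator `x ^ g` is not involved in any nontrivial
relation between coefficients of tangent vectors. -/
def isolated (L : List (List ℕ)) (g d : Exponent) : Bool :=
  (genList L).all fun h => !inStd L (upTo g h d) || decide (g = h)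

/-- The coefficients that are not involved in any nontrivial relation. -/
def isolatedNodes (L : List (List ℕ)) : List (Exponent × Exponent) :=
  (genList L ×ˢ stdList L).filter fun p => isolated L p.1 p.2

section Staircase

lemma expo_le_iff {s t : Exponent} : expo s ≤ expo t ↔ s ≤ t := by
  simp [Finsupp.le_def, expo, Fin.forall_fin_succ, Prod.le_def]

lemma expo_coords (d : Fin 3 →₀ ℕ) : expo (d 0, d 1, d 2) = d := by
  ext i
  fin_cases i <;> rfl

lemma expo_injective : Function.Injective expo := fun _ _ h =>
  le_antisymm (expo_le_iff.mp h.le) (expo_le_iff.mp h.ge)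

lemma expo_upTo (g h d : Exponent) : expo d + (expo h - expo g) = expo (upTo g h d) := by
  ext i
  fin_cases i <;> rfl

lemma expo_transport (g h d : Exponent) : expo d + expo h - expo g = expo (transport g h d) := by
  ext i
  fin_cases i <;> rfl

lemma expo_le_add_iff {g h d : Exponent} :
    expo g ≤ expo d + expo h ↔ transports g h d = true := by
  rw [transports_iff]
  simp [Finsupp.le_def, expo, Fin.forall_fin_succ]

lemma nodup_stdList (L : List (List ℕ)) : (stdList L).Nodup := by
  simp only [stdList, List.nodup_flatMap]
  refine ⟨fun i _ => ⟨fun j _ => ?_, ?_⟩, ?_⟩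
  · exact List.nodup_range.map fun k k' h => by simpa using h
  · refine List.nodup_range.pairwise_of_forall_ne fun j _ j' _ hjj' => ?_
    rw [Function.onFun, List.disjoint_left]
    simp only [List.mem_map]
    rintro _ ⟨k, _, rfl⟩ ⟨k', _, h⟩
    exact hjj' (by simpa using (congrArg (fun t : Exponent => t.2.1) h).symm)
  · refine List.nodup_range.pairwise_of_forall_ne fun i _ i' _ hii' => ?_
    rw [Function.onFun, List.disjoint_left]
    simp only [List.mem_flatMap, List.mem_map]
    rintro _ ⟨j, _, k, _, rfl⟩ ⟨j', _, k', _, h⟩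
    exact hii' (by simpa using (congrArg (fun t : Exponent => t.1) h).symm)

lemma nodup_genList (L : List (List ℕ)) : (genList L).Nodup := by
  rw [genList, List.nodup_append, List.nodup_flatMap]
  refine ⟨⟨fun i _ => ?_, ?_⟩, List.nodup_singleton _, ?_⟩
  · exact List.nodup_range.map fun j j' h => congrArg (fun t : Exponent => t.2.1) h
  · refine List.nodup_range.pairwise_of_forall_ne fun i _ i' _ hii' => ?_
    rw [Function.onFun, List.disjoint_left]
    simp only [List.mem_map]
    rintro _ ⟨j, _, rfl⟩ ⟨j', _, h⟩
    exact hii' (congrArg (fun t : Exponent => t.1) h).symm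
  · simp only [List.mem_flatMap, List.mem_range, List.mem_map, List.mem_singleton]
    rintro _ ⟨i, hi, j, _, rfl⟩ _ rfl h
    exact hi.ne (congrArg (fun t : Exponent => t.1) h)

variable {I : Ideal (MvPolynomial (Fin 3) ℂ)} {L : List (List ℕ)}

lemma HasTable.notMem_iff (hT : HasTable I L) {t : Exponent} :
    monomial (expo t) (1 : ℂ) ∉ I ↔ inStd L t = true := by
  rw [hT t, Bool.not_eq_false]

lemma HasTable.inStd_of_le (hT : HasTable I L) {s t : Exponent} (hst : s ≤ t)
    (ht : inStd L t = true) : inStd L s = true := by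
  rw [← hT.notMem_iff] at ht ⊢
  exact fun h => ht (monomial_mem_of_le h (expo_le_iff.mpr hst))

lemma HasTable.setOf_notMem_eq (hT : HasTable I L) :
    {d : Fin 3 →₀ ℕ | monomial d (1 : ℂ) ∉ I} = expo '' (stdList L).toFinset := by
  ext d
  constructor
  · intro hd
    refine ⟨(d 0, d 1, d 2), ?_, expo_coords d⟩
    rw [List.coe_toFinset, Set.mem_ofPred_eq, mem_stdList, ← hT.notMem_iff, expo_coords]
    exact hd
  · rintro ⟨t, ht, rfl⟩
    rw [List.coe_toFinset, Set.mem_ofPred_eq, mem_stdList, ← hT.notMem_iff] at ht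
    exact ht

lemma HasTable.finite (hT : HasTable I L) :
    {d : Fin 3 →₀ ℕ | monomial d (1 : ℂ) ∉ I}.Finite := by
  rw [hT.setOf_notMem_eq]
  exact (Finset.finite_toSet _).image _

lemma HasTable.finrank_quotient (hI : IsMonomialIdeal I) (hT : HasTable I L) :
    Module.finrank ℂ (MvPolynomial (Fin 3) ℂ ⧸ I) = (stdList L).length := by
  rw [finrank_quotient_eq_card hI, ← List.toFinset_card_of_nodup (nodup_stdList L)]
  change {d : Fin 3 →₀ ℕ | monomial d (1 : ℂ) ∉ I}.ncard = _
  rw [hT.setOf_notMem_eq, Set.ncard_image_of_injective _ expo_injective, Set.ncard_coe_finset]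

lemma HasTable.exists_gen_le (hT : HasTable I L) {m : Fin 3 →₀ ℕ}
    (hm : monomial m (1 : ℂ) ∈ I) : ∃ g ∈ genList L, expo g ≤ m := by
  rw [← expo_coords m, hT] at hm
  obtain ⟨g, hg, hgm⟩ := exists_mem_genList hm
  exact ⟨g, hg, by rwa [← expo_coords m, expo_le_iff]⟩

lemma HasTable.gen_mem (hT : HasTable I L) {g : Exponent} (hg : g ∈ genList L) :
    monomial (expo g) (1 : ℂ) ∈ I :=
  (hT g).mpr (inStd_of_mem_genList hg)

lemma HasTable.exists_injective (hI : IsMonomialIdeal I) (hT : HasTable I L) {b : ℕ}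
    (hb : boundedBy L b = true) : ∃ n ≤ b,
      ∃ ev : (↥I →ₗ[MvPolynomial (Fin 3) ℂ] (MvPolynomial (Fin 3) ℂ ⧸ I)) →ₗ[ℂ] (Fin n → ℂ),
        Function.Injective ev := by
  obtain ⟨S, hS, hdet⟩ := exists_determining_nodes hb fun _ _ => hT.inStd_of_le
  refine ⟨S.length, hS, LinearMap.pi fun i => homCoeff hI (expo (S.get i).1) (expo (S.get i).2),
    (injective_iff_map_eq_zero _).mpr fun φ hφ => ?_⟩
  refine hom_eq_zero hI (G := expo '' {g | g ∈ genList L}) (fun m hm => ?_) φ ?_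
  · obtain ⟨g, hg, hgm⟩ := hT.exists_gen_le hm
    exact ⟨_, ⟨g, hg, rfl⟩, hgm, hT.gen_mem hg⟩
  · rintro _ ⟨g, hg, rfl⟩ d hd
    rw [← expo_coords d] at hd ⊢
    refine hdet (fun g d => homCoeff hI (expo g) (expo d) φ) (fun g hg h hh d hu => ?_)
      (fun p hp => ?_) g hg _ (hT.notMem_iff.mp hd)
    · rw [homCoeff_relation hI (hT.gen_mem hg) (hT.gen_mem hh)
        (by rw [expo_upTo]; exact hT.notMem_iff.mpr hu)]
      simp only [expo_le_add_iff, expo_transport]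
    · obtain ⟨i, rfl⟩ := List.get_of_mem hp
      exact congrFun hφ i

lemma HasTable.tangentDim_le (hI : IsMonomialIdeal I) (hT : HasTable I L) {b : ℕ}
    (hb : boundedBy L b = true) : tangentDim I ≤ b := by
  obtain ⟨n, hn, ev, hev⟩ := hT.exists_injective hI hb
  refine le_trans ?_ hn
  simpa [tangentDim] using LinearMap.finrank_le_finrank_of_injective hev

lemma isolated_iff {g d : Exponent} : isolated L g d = true ↔
    ∀ h ∈ genList L, inStd L (upTo g h d) = true → g = h := by
  simp only [isolated, List.all_eq_true, Bool.or_eq_true, decide_eq_true_eq, Bool.not_eq_true',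
    ← Bool.not_eq_true, ← imp_iff_not_or]

lemma upTo_transport {g h d : Exponent} (ht : transports g h d = true) :
    upTo h g (transport g h d) = upTo g h d := by
  rw [transports_iff] at ht
  simp only [upTo, transport, Prod.mk.injEq]
  omega

lemma mem_isolatedNodes {p : Exponent × Exponent} : p ∈ isolatedNodes L ↔
    (p.1 ∈ genList L ∧ inStd L p.2 = true) ∧ isolated L p.1 p.2 = true := by
  obtain ⟨g, d⟩ := p
  rw [isolatedNodes, List.mem_filter, List.mem_product, mem_stdList]

lemma nodup_isolatedNodes (L : List (List ℕ)) : (isolatedNodes L).Nodup :=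
  ((nodup_genList L).product (nodup_stdList L)).filter _

lemma HasTable.exists_hom_of_isolated (hI : IsMonomialIdeal I) (hT : HasTable I L)
    {p : Exponent × Exponent} (hp : p ∈ isolatedNodes L) :
    ∃ φ : ↥I →ₗ[MvPolynomial (Fin 3) ℂ] (MvPolynomial (Fin 3) ℂ ⧸ I),
      ∀ g ∈ genList L, ∀ d, inStd L d = true →
        homCoeff hI (expo g) (expo d) φ = if (g, d) = p then 1 else 0 := by
  have hiso := isolated_iff.mp (mem_isolatedNodes.mp hp).2
  obtain ⟨φ, hφ⟩ := exists_hom hI (G := expo '' {g | g ∈ genList L})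
    (by rintro _ ⟨g, hg, rfl⟩; exact hT.gen_mem hg)
    (fun m hm => by
      obtain ⟨g, hg, hgm⟩ := hT.exists_gen_le hm
      exact ⟨_, ⟨g, hg, rfl⟩, hgm⟩)
    hT.finite
    (fun g d => if ((g 0, g 1, g 2), (d 0, d 1, d 2)) = p then 1 else 0) (by
      rintro _ ⟨g, hg, rfl⟩ _ ⟨h, hh, rfl⟩ d hu
      rw [← expo_coords d] at hu ⊢
      generalize (d 0, d 1, d 2) = d at hu
      rw [expo_upTo, hT.notMem_iff] at hu
      simp only [expo_le_add_iff, expo_transport]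
      change (if (g, d) = p then (1 : ℂ) else 0) = if transports g h d = true then
        (if (h, transport g h d) = p then (1 : ℂ) else 0) else 0
      rcases eq_or_ne g h with rfl | hgh
      · simp [transports, transport]
      · rw [if_neg fun he => hgh (by subst he; exact hiso h hh hu)]
        split_ifs with ht he
        · subst he
          exact absurd (hiso g hg (by rwa [upTo_transport ht])) hgh.symm
        · rfl
        · rfl)
  exact ⟨φ, fun g hg d hd => hφ _ ⟨g, hg, rfl⟩ _ (hT.notMem_iff.mpr hd)⟩

lemma HasTable.length_isolatedNodes_le (hI : IsMonomialIdeal I) (hT : HasTable I L)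
    {b : ℕ} (hb : boundedBy L b = true) : (isolatedNodes L).length ≤ tangentDim I := by
  obtain ⟨n, _, ev, hev⟩ := hT.exists_injective hI hb
  have : Module.Finite ℂ (↥I →ₗ[MvPolynomial (Fin 3) ℂ] (MvPolynomial (Fin 3) ℂ ⧸ I)) :=
    Module.Finite.of_injective ev hev
  choose φ hφ using fun p : (isolatedNodes L).toFinset =>
    hT.exists_hom_of_isolated hI (List.mem_toFinset.mp p.2)
  have hli : LinearIndependent ℂ φ := by
    rw [linearIndependent_iff']
    intro s a ha p hp
    obtain ⟨⟨hg, hd⟩, -⟩ := mem_isolatedNodes.mp (List.mem_toFinset.mp p.2)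
    have := congrArg (homCoeff hI (expo p.1.1) (expo p.1.2)) ha
    rw [map_sum, map_zero, Finset.sum_eq_single p] at this
    · simpa [hφ _ _ hg _ hd] using this
    · intro q _ hqp
      rw [map_smul, hφ _ _ hg _ hd, if_neg fun h => hqp (Subtype.ext h.symm), smul_zero]
    · exact fun h => (h hp).elim
  rw [← List.toFinset_card_of_nodup (nodup_isolatedNodes L), ← Fintype.card_coe]
  exact hli.fintype_card_le_finrank

end Staircase

/-! ### Enumeration of the staircases of Borel-fixed ideals -/

/-- The possible rows of a table bounded entrywise by a given row, with first entry at most `m` and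
sum at most `n`. -/
def rows : List ℕ → ℕ → ℕ → List (List ℕ)
  | [], _, _ => [[]]
  | b :: bs, m, n => [] :: (List.range (min b (min m n))).flatMap fun a =>
        (rows bs a (n - (a + 1))).map fun r => (a + 1) :: r

/-- The tables with at most `k` rows, with sum `n` and first row bounded by `b`. -/
def tables : ℕ → List ℕ → ℕ → List (List (List ℕ))
  | 0, _, _ => [[]]
  | k + 1, b, n => (if n = 0 then [[]] else []) ++
      ((rows b n n).filter (fun r => r ≠ [])).flatMap fun r =>
        (tables k r.tail (n - r.sum)).map fun L => r :: L

/-- The values of `f` before its first zero, up to `N` of them. -/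
def trim (f : ℕ → ℕ) : ℕ → List ℕ
  | 0 => []
  | N + 1 => if f 0 = 0 then [] else f 0 :: trim (fun j => f (j + 1)) N

/-- The table of a height function. -/
def tab (h : ℕ → ℕ → ℕ) (N : ℕ) : ℕ → List (List ℕ)
  | 0 => []
  | K + 1 => if h 0 0 = 0 then [] else trim (h 0) N :: tab (fun i => h (i + 1)) N K

section Enumeration

lemma trim_mem_rows {f : ℕ → ℕ} (hf : ∀ j, f (j + 1) ≤ f j - 1) {N : ℕ} {bs : List ℕ} {m n : ℕ}
    (hm : f 0 ≤ m) (hb : ∀ j, f j ≤ bs.getD j 0) (hn : (trim f N).sum ≤ n) :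
    trim f N ∈ rows bs m n := by
  induction bs generalizing f N m n with
  | nil =>
    have h0 : f 0 = 0 := by simpa using hb 0
    cases N <;> simp [trim, rows, h0]
  | cons b bs ih =>
    cases N with
    | zero => simp [trim, rows]
    | succ N =>
      by_cases h0 : f 0 = 0
      · simp [trim, rows, h0]
      · have hb0 : f 0 ≤ b := by simpa using hb 0
        have h1 := hf 0
        simp only [trim, h0, if_false, List.sum_cons] at hn ⊢
        rw [rows, List.mem_cons, List.mem_flatMap]
        refine Or.inr ⟨f 0 - 1, by rw [List.mem_range]; omega, ?_⟩
        rw [List.mem_map, Nat.sub_add_cancel (by omega)]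
        exact ⟨_, ih (fun j => hf (j + 1)) h1 (fun j => by simpa using hb (j + 1)) (by omega), rfl⟩

lemma eq_zero_of_zero {f : ℕ → ℕ} (hf : ∀ j, f (j + 1) ≤ f j - 1) (h0 : f 0 = 0) (j : ℕ) :
    f j = 0 := by
  induction j with
  | zero => exact h0
  | succ j ih =>
    have := hf j
    omega

lemma getD_trim {f : ℕ → ℕ} (hf : ∀ j, f (j + 1) ≤ f j - 1) {N : ℕ} (hN : f N = 0) (j : ℕ) :
    (trim f N).getD j 0 = f j := by
  induction N generalizing f j with
  | zero => rw [eq_zero_of_zero hf hN]; rfl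
  | succ N ih =>
    by_cases h0 : f 0 = 0
    · simp [trim, h0, eq_zero_of_zero hf h0]
    · cases j with
      | zero => simp [trim, h0]
      | succ j =>
        simp only [trim, h0, if_false, List.getD_cons_succ]
        exact ih (fun j => hf (j + 1)) hN j

variable {h : ℕ → ℕ → ℕ}

lemma tab_mem_tables (hrow : ∀ i j, h i (j + 1) ≤ h i j - 1)
    (hcol : ∀ i j, h (i + 1) j ≤ h i (j + 1)) {N : ℕ} (hN : ∀ i, h i N = 0) {K k : ℕ} (hK : K ≤ k)
    {b : List ℕ} (hb : ∀ j, h 0 j ≤ b.getD j 0) {n : ℕ}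
    (hn : ((tab h N K).map List.sum).sum = n) : tab h N K ∈ tables k b n := by
  induction K generalizing h k b n with
  | zero =>
    cases k with
    | zero => simp [tab, tables]
    | succ k => simp [tables, tab, ← hn]
  | succ K ih =>
    obtain ⟨k, rfl⟩ : ∃ k', k = k' + 1 := ⟨k - 1, by omega⟩
    by_cases h0 : h 0 0 = 0
    · simp [tables, tab, h0, ← hn]
    · have hne : trim (h 0) N ≠ [] := by
        cases N with
        | zero => exact absurd (hN 0) h0
        | succ N => simp [trim, h0]
      have hle : h 0 0 ≤ (trim (h 0) N).sum := by
        cases N with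
        | zero => exact absurd (hN 0) h0
        | succ N => simp [trim, h0]
      simp only [tab, h0, if_false, List.map_cons, List.sum_cons] at hn ⊢
      rw [tables, List.mem_append, List.mem_flatMap]
      have hmem : trim (h 0) N ∈ rows b n n :=
        trim_mem_rows (hrow 0) (by omega) hb (by omega)
      refine Or.inr ⟨_, List.mem_filter.mpr ⟨hmem, by simpa using hne⟩,
        List.mem_map_of_mem (ih (fun i => hrow (i + 1)) (fun i => hcol (i + 1))
        (fun i => hN (i + 1)) (Nat.le_of_succ_le_succ hK) (fun j => ?_) (Nat.eq_sub_of_add_eq' hn))⟩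
      have := getD_trim (hrow 0) (hN 0) (j + 1)
      rw [List.getD_eq_getElem?_getD, List.getElem?_tail, ← List.getD_eq_getElem?_getD, this]
      exact hcol 0 j

lemma height_tab (hrow : ∀ i j, h i (j + 1) ≤ h i j - 1)
    (hcol : ∀ i j, h (i + 1) j ≤ h i (j + 1)) {N : ℕ} (hN : ∀ i, h i N = 0) {K : ℕ}
    (hK : h K 0 = 0) (i j : ℕ) : height (tab h N K) i j = h i j := by
  have hzero : h 0 0 = 0 → h i j = 0 := fun h0 => by
    refine eq_zero_of_zero (hrow i) (eq_zero_of_zero (f := fun i => h i 0) (fun i => ?_) h0 i) j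
    exact (hcol i 0).trans (hrow i 0)
  induction K generalizing h i j with
  | zero => rw [hzero hK]; rfl
  | succ K ih =>
    by_cases h0 : h 0 0 = 0
    · simp [tab, h0, height, hzero]
    · cases i with
      | zero =>
        simp only [tab, h0, if_false, height, List.getD_cons_zero]
        exact getD_trim (hrow 0) (hN 0) j
      | succ i =>
        simp only [tab, h0, if_false, height, List.getD_cons_succ]
        refine ih (fun i => hrow (i + 1)) (fun i => hcol (i + 1)) (fun i => hN (i + 1)) hK i j ?_
        intro h1
        refine eq_zero_of_zero (hrow (i + 1))
          (eq_zero_of_zero (f := fun i => h (i + 1) 0) (fun i => ?_) h1 i) j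
        exact (hcol (i + 1) 0).trans (hrow (i + 1) 0)

lemma pos_of_lt_length_tab {N K i : ℕ} (hi : i < (tab h N K).length) : 0 < h i 0 := by
  induction K generalizing h i with
  | zero => simp [tab] at hi
  | succ K ih =>
    by_cases h0 : h 0 0 = 0
    · simp [tab, h0] at hi
    · cases i with
      | zero => exact Nat.pos_of_ne_zero h0
      | succ i =>
        simp only [tab, h0, if_false, List.length_cons, Nat.succ_lt_succ_iff] at hi
        exact ih (h := fun i => h (i + 1)) hi

lemma map_getD_range {α : Type} (l : List α) (a : α) :
    (List.range l.length).map (fun j => l.getD j a) = l := by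
  refine List.ext_getElem (by simp) fun i h1 h2 => ?_
  rw [List.getElem_map, List.getElem_range, List.getD_eq_getElem _ _ h2]

lemma length_stdList (L : List (List ℕ)) : (stdList L).length = (L.map List.sum).sum := by
  have hrow : ∀ i, ((List.range (L.getD i []).length).map fun j => height L i j).sum =
      (L.getD i []).sum := fun i => congrArg List.sum (map_getD_range _ _)
  simp only [stdList, List.length_flatMap, List.length_map, List.length_range, hrow]
  conv_rhs => rw [← map_getD_range L []]
  rw [List.map_map]
  rfl

end Enumeration

/-! ### The table of a Borel-fixed ideal -/

section TableOfIdeal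

variable {I : Ideal (MvPolynomial (Fin 3) ℂ)}

lemma lt_finrank_of_notMem (hI : IsMonomialIdeal I)
    (h0 : Module.finrank ℂ (MvPolynomial (Fin 3) ℂ ⧸ I) ≠ 0) {d : Fin 3 →₀ ℕ}
    (hd : monomial d (1 : ℂ) ∉ I) (s : Fin 3) :
    d s < Module.finrank ℂ (MvPolynomial (Fin 3) ℂ ⧸ I) := by
  rw [finrank_quotient_eq_card hI] at h0 ⊢
  have := Nat.finite_of_card_ne_zero h0
  have hinj := Nat.card_le_card_of_injective
    (fun t : Fin (d s + 1) => (⟨Finsupp.single s t, fun h => hd (monomial_mem_of_le h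
      (Finsupp.single_le_iff.mpr (Nat.le_of_lt_succ t.2)))⟩ :
        {d : Fin 3 →₀ ℕ // monomial d (1 : ℂ) ∉ I}))
    (fun t t' h => Fin.ext (Finsupp.single_injective s (congrArg Subtype.val h)))
  rw [Nat.card_fin] at hinj
  omega

lemma IsBorelFixed.expo_mem (hB : IsBorelFixed I) {t : Exponent}
    (ht : monomial (expo t) (1 : ℂ) ∈ I) :
    (0 < t.2.1 → monomial (expo (t.1 + 1, t.2.1 - 1, t.2.2)) (1 : ℂ) ∈ I) ∧
      (0 < t.2.2 → monomial (expo (t.1, t.2.1 + 1, t.2.2 - 1)) (1 : ℂ) ∈ I) := by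
  refine ⟨fun h => ?_, fun h => ?_⟩
  · convert hB _ ht 0 1 (by decide) h using 3
    ext i
    rw [Finsupp.tsub_apply, Finsupp.add_apply]
    fin_cases i <;> simp [expo]
  · convert hB _ ht 1 2 (by decide) h using 3
    ext i
    rw [Finsupp.tsub_apply, Finsupp.add_apply]
    fin_cases i <;> simp [expo]

lemma X_pow_eq_monomial_expo (m : ℕ) :
    (X 0 : MvPolynomial (Fin 3) ℂ) ^ m = monomial (expo (m, 0, 0)) 1 := by
  rw [X_pow_eq_monomial]
  refine congrArg (fun d => monomial d (1 : ℂ)) (Finsupp.ext fun i => ?_)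
  fin_cases i <;> simp [expo]

lemma exists_mem_tables (hI : IsMonomialIdeal I) (hB : IsBorelFixed I) {l m : ℕ} (hl : l ≠ 0)
    (hfin : Module.finrank ℂ (MvPolynomial (Fin 3) ℂ ⧸ I) = l)
    (hm : (X 0 : MvPolynomial (Fin 3) ℂ) ^ m ∈ I)
    (hm' : (X 0 : MvPolynomial (Fin 3) ℂ) ^ (m - 1) ∉ I) :
    ∃ L ∈ tables l (List.replicate l l) l, HasTable I L ∧ L.length = m := by
  have hmem : ∀ t : Exponent, l ≤ t.1 ∨ l ≤ t.2.1 ∨ l ≤ t.2.2 →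
      monomial (expo t) (1 : ℂ) ∈ I := by
    intro t ht
    by_contra hd
    have hlt := lt_finrank_of_notMem hI (hfin ▸ hl) hd
    rw [hfin] at hlt
    have h0 : t.1 < l := hlt 0
    have h1 : t.2.1 < l := hlt 1
    have h2 : t.2.2 < l := hlt 2
    omega
  set h : ℕ → ℕ → ℕ := fun i j => sInf {k | monomial (expo (i, j, k)) (1 : ℂ) ∈ I} with hh
  have hspec : ∀ i j k, monomial (expo (i, j, k)) (1 : ℂ) ∈ I ↔ h i j ≤ k := by
    intro i j k
    refine ⟨fun hk => Nat.sInf_le hk, fun hk => ?_⟩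
    have : h i j ∈ {k | monomial (expo (i, j, k)) (1 : ℂ) ∈ I} :=
      Nat.sInf_mem ⟨l, hmem (i, j, l) (by simp)⟩
    exact monomial_mem_of_le this (expo_le_iff.mpr ⟨le_rfl, le_rfl, hk⟩)
  have hrow : ∀ i j, h i (j + 1) ≤ h i j - 1 := by
    intro i j
    have h1 := (hspec i j (h i j)).mpr le_rfl
    rw [← hspec]
    rcases Nat.eq_zero_or_pos (h i j) with h0 | h0
    · rw [h0] at h1 ⊢
      exact monomial_mem_of_le h1 (expo_le_iff.mpr ⟨le_rfl, Nat.le_succ j, le_rfl⟩)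
    · exact (hB.expo_mem h1).2 h0
  have hcol : ∀ i j, h (i + 1) j ≤ h i (j + 1) := fun i j => (hspec _ _ _).mp
    ((hB.expo_mem ((hspec i (j + 1) _).mpr le_rfl)).1 (Nat.succ_pos j))
  have hN : ∀ i, h i l = 0 := fun i =>
    Nat.le_zero.mp ((hspec _ _ _).mp (hmem (i, l, 0) (by simp)))
  have hK : h l 0 = 0 := Nat.le_zero.mp ((hspec _ _ _).mp (hmem (l, 0, 0) (by simp)))
  have hheight := height_tab hrow hcol hN hK
  have hT : HasTable I (tab h l l) := by
    rintro ⟨i, j, k⟩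
    rw [hspec, inStd_eq_false_iff, hheight]
  refine ⟨_, ?_, hT, ?_⟩
  · refine tab_mem_tables hrow hcol hN le_rfl (fun j => ?_) ?_
    · rcases lt_or_ge j l with hj | hj
      · rw [List.getD_eq_getElem _ _ (by simpa using hj), List.getElem_replicate, ← hspec]
        exact hmem _ (by simp)
      · rw [(hspec 0 j 0).mp (hmem _ (by simp [hj])) |> Nat.le_zero.mp]
        exact Nat.zero_le _
    · rw [← length_stdList, ← hT.finrank_quotient hI, hfin]
  · rw [X_pow_eq_monomial_expo, hspec] at hm hm'
    refine le_antisymm ?_ ?_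
    · by_contra! hlt
      have := pos_of_lt_length_tab hlt
      omega
    · by_contra! hlt
      have := height_of_length_le (L := tab h l l) (i := m - 1) (by omega) 0
      rw [hheight] at this
      omega

end TableOfIdeal

/-! ### The ideal of a staircase -/

/-- The conditions on a table for its staircase to be that of a Borel-fixed ideal. -/
def isBorelTable (L : List (List ℕ)) : Bool :=
  (List.range (L.length + 1)).all fun i => (List.range ((L.getD i []).length + 1)).all fun j =>
    Nat.ble (height L i (j + 1)) (height L i j - 1) &&
      Nat.ble (height L (i + 1) j) (height L i (j + 1))

/-- The monomial ideal above a staircase. -/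
noncomputable def staircaseIdeal (L : List (List ℕ)) : Ideal (MvPolynomial (Fin 3) ℂ) :=
  Ideal.span ((fun d => monomial d (1 : ℂ)) '' {d | inStd L (d 0, d 1, d 2) = false})

section StaircaseIdeal

variable {L : List (List ℕ)}

lemma height_succ_right_of_isBorelTable (hL : isBorelTable L = true) (i j : ℕ) :
    height L i (j + 1) ≤ height L i j - 1 := by
  by_cases h : i < L.length + 1 ∧ j < (L.getD i []).length + 1
  · simp only [isBorelTable, List.all_eq_true, List.mem_range, Bool.and_eq_true,
      Nat.ble_eq] at hL
    exact (hL i h.1 j h.2).1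
  · rw [not_and_or, not_lt, not_lt] at h
    rcases h with h | h
    · rw [height_of_length_le (by omega)]
      exact Nat.zero_le _
    · rw [height_of_row_length_le (by omega)]
      exact Nat.zero_le _

lemma height_succ_left_of_isBorelTable (hL : isBorelTable L = true) (i j : ℕ) :
    height L (i + 1) j ≤ height L i (j + 1) := by
  have hanti : Antitone (height L (i + 1)) :=
    antitone_nat_of_succ_le fun j =>
      (height_succ_right_of_isBorelTable hL _ _).trans (Nat.sub_le _ _)
  rcases le_or_gt L.length i with hi | hi
  · rw [height_of_length_le (by omega)]
    exact Nat.zero_le _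
  · have hcol : ∀ j < (L.getD i []).length + 1, height L (i + 1) j ≤ height L i (j + 1) := by
      simp only [isBorelTable, List.all_eq_true, List.mem_range, Bool.and_eq_true,
        Nat.ble_eq] at hL
      exact fun j hj => (hL i (by omega) j hj).2
    rcases lt_or_ge j ((L.getD i []).length + 1) with hj | hj
    · exact hcol j hj
    · have := hcol _ (Nat.lt_succ_self (L.getD i []).length)
      rw [height_of_row_length_le (Nat.le_succ _)] at this
      exact ((hanti (by omega)).trans this).trans (Nat.zero_le _)

lemma inStd_eq_false_of_le_of_isBorelTable (hL : isBorelTable L = true) {s t : Exponent}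
    (hst : s ≤ t) (hs : inStd L s = false) : inStd L t = false := by
  rw [inStd_eq_false_iff] at hs ⊢
  have hr : Antitone (height L s.1) :=
    antitone_nat_of_succ_le fun j =>
      (height_succ_right_of_isBorelTable hL _ _).trans (Nat.sub_le _ _)
  have hc : Antitone fun i => height L i t.2.1 :=
    antitone_nat_of_succ_le fun i => (height_succ_left_of_isBorelTable hL _ _).trans
      ((height_succ_right_of_isBorelTable hL _ _).trans (Nat.sub_le _ _))
  exact (((hc hst.1).trans (hr hst.2.1)).trans hs).trans hst.2.2

lemma mem_staircaseIdeal (hL : isBorelTable L = true) {p : MvPolynomial (Fin 3) ℂ} :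
    p ∈ staircaseIdeal L ↔ ∀ d ∈ p.support, inStd L (d 0, d 1, d 2) = false := by
  rw [staircaseIdeal, mem_ideal_span_monomial_image]
  refine forall₂_congr fun d _ => ⟨?_, fun h => ⟨d, h, le_rfl⟩⟩
  rintro ⟨e, he, hed⟩
  exact inStd_eq_false_of_le_of_isBorelTable hL ⟨hed 0, hed 1, hed 2⟩ he

lemma monomial_mem_staircaseIdeal (hL : isBorelTable L = true) {d : Fin 3 →₀ ℕ} :
    monomial d (1 : ℂ) ∈ staircaseIdeal L ↔ inStd L (d 0, d 1, d 2) = false := by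
  simp [mem_staircaseIdeal hL, support_monomial]

lemma isMonomialIdeal_staircaseIdeal (hL : isBorelTable L = true) :
    IsMonomialIdeal (staircaseIdeal L) := fun _ hp d hd =>
  (monomial_mem_staircaseIdeal hL).mpr ((mem_staircaseIdeal hL).mp hp d hd)

lemma hasTable_staircaseIdeal (hL : isBorelTable L = true) : HasTable (staircaseIdeal L) L :=
  fun _ => monomial_mem_staircaseIdeal hL

lemma isBorelFixed_staircaseIdeal (hL : isBorelTable L = true) :
    IsBorelFixed (staircaseIdeal L) := by
  intro d hd i j hij hj
  rw [monomial_mem_staircaseIdeal hL, inStd_eq_false_iff] at hd ⊢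
  dsimp only at hd
  simp only [Finsupp.tsub_apply, Finsupp.add_apply]
  fin_cases i <;> fin_cases j <;> simp at hij hj ⊢
  · have := height_succ_left_of_isBorelTable hL (d 0) (d 1 - 1)
    rw [Nat.sub_add_cancel hj] at this
    exact this.trans hd
  · have h1 := height_succ_left_of_isBorelTable hL (d 0) (d 1)
    have h2 := height_succ_right_of_isBorelTable hL (d 0) (d 1)
    omega
  · have := height_succ_right_of_isBorelTable hL (d 0) (d 1)
    omega

end StaircaseIdeal

section Maximum

lemma boundedBy_of_mem_tables : ∀ L ∈ tables 20 (List.replicate 20 20) 20,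
    boundedBy L ([0, 95, 96, 126, 150].getD L.length 0) = true :=
  List.all_eq_true.mp (by decide +kernel)

lemma tangentDim_le_of_mem {m t : ℕ}
    (ht : t ∈ { t : ℕ | ∃ I : Ideal (MvPolynomial (Fin 3) ℂ),
      IsMonomialIdeal I ∧ IsBorelFixed I ∧
      Module.finrank ℂ (MvPolynomial (Fin 3) ℂ ⧸ I) = 20 ∧
      (X 0 : MvPolynomial (Fin 3) ℂ) ^ m ∈ I ∧
      (X 0 : MvPolynomial (Fin 3) ℂ) ^ (m - 1) ∉ I ∧
      t = tangentDim I }) : t ≤ [0, 95, 96, 126, 150].getD m 0 := by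
  obtain ⟨I, hI, hB, hfin, hm, hm', rfl⟩ := ht
  obtain ⟨L, hL, hT, rfl⟩ := exists_mem_tables hI hB (by norm_num) hfin hm hm'
  exact hT.tangentDim_le hI (boundedBy_of_mem_tables L hL)

lemma TmaxEq_of_table (L : List (List ℕ)) {b : ℕ} (hL : isBorelTable L = true)
    (hlen : (stdList L).length = 20)
    (hL0 : inStd L (L.length, 0, 0) = false) (hL1 : inStd L (L.length - 1, 0, 0) = true)
    (hb : [0, 95, 96, 126, 150].getD L.length 0 = b) (hbound : boundedBy L b = true)
    (hiso : (isolatedNodes L).length = b) : TmaxEq 20 L.length b := by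
  have hI := isMonomialIdeal_staircaseIdeal hL
  have hT := hasTable_staircaseIdeal hL
  refine ⟨⟨staircaseIdeal L, hI, isBorelFixed_staircaseIdeal hL, ?_, ?_, ?_, ?_⟩,
    fun t ht => hb ▸ tangentDim_le_of_mem ht⟩
  · rw [hT.finrank_quotient hI, hlen]
  · rwa [X_pow_eq_monomial_expo, hT]
  · rwa [X_pow_eq_monomial_expo, hT.notMem_iff]
  · exact le_antisymm (hiso ▸ hT.length_isolatedNodes_le hI hbound) (hT.tangentDim_le hI hbound)

lemma TmaxEq_two : TmaxEq 20 2 96 :=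
  TmaxEq_of_table [[6, 4, 2, 1], [4, 2, 1]] (by decide) (by decide) (by decide) (by decide) rfl
    (by decide +kernel) (by decide +kernel)

lemma TmaxEq_three : TmaxEq 20 3 126 :=
  TmaxEq_of_table [[5, 3, 2, 1], [3, 2, 1], [2, 1]] (by decide) (by decide) (by decide)
    (by decide) rfl (by decide +kernel) (by decide +kernel)

lemma TmaxEq_four : TmaxEq 20 4 150 :=
  TmaxEq_of_table [[4, 3, 2, 1], [3, 2, 1], [2, 1], [1]] (by decide) (by decide) (by decide)
    (by decide) rfl (by decide +kernel) (by decide +kernel)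

end Maximum

theorem Tmax_monotonicity_l20 :
    TmaxEq 20 2 96 ∧
    TmaxEq 20 3 126 ∧
    TmaxEq 20 4 150 ∧
    (∀ T1 T2 T3 T4 : ℕ, TmaxEq 20 1 T1 → TmaxEq 20 2 T2 → TmaxEq 20 3 T3 → TmaxEq 20 4 T4 →
      T1 < T2 ∧ T2 < T3 ∧ T3 < T4) := by
  refine ⟨TmaxEq_two, TmaxEq_three, TmaxEq_four, fun T1 T2 T3 T4 h1 h2 h3 h4 => ?_⟩
  obtain rfl := h2.unique TmaxEq_two
  obtain rfl := h3.unique TmaxEq_three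
  obtain rfl := h4.unique TmaxEq_four
  have : T1 ≤ 95 := tangentDim_le_of_mem h1.1
  omega
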